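/- Let X be a Polish space and let G ⊆ X × X be an analytic directed graph on X. Suppose there is no countable Σ^0_3 colouring of G, i.e., there is no countable family (C_n)_{n∈ℕ} of Σ^0_3 subsets of X whose union is all of X and such that no C_n contains both endpoints of an edge of G. Then there is a continuous function f : Y_3 → X (with Y_3 carrying the subspace topology from X_3) such that for every H_3-edge (a,b), the pair (f(a),f(b)) is an edge of G. -/

import Mathlib

open Classical

/-- The space `X₃ = 2^{ℕ³} × 2^ℕ`. -/
abbrev XThree : Type := (ℕ × ℕ × ℕ → Bool) × (ℕ → Bool)

/-- `T^x(m,k) = 0`, i.e. `x(m,k,a) = 1` for some `a`. -/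
def lvl2Zero (x : ℕ × ℕ × ℕ → Bool) (m k : ℕ) : Prop := ∃ a : ℕ, x (m, k, a) = true

/-- `T^x(m) = 0`, i.e. `T^x(m,k) = 1` for some `k`. -/
def lvl1Zero (x : ℕ × ℕ × ℕ → Bool) (m : ℕ) : Prop := ∃ k : ℕ, ¬ lvl2Zero x m k

/-- `T^x(⟨⟩) = 0`, i.e. `T^x(m) = 1` for some `m`. -/
def rootZero (x : ℕ × ℕ × ℕ → Bool) : Prop := ∃ m : ℕ, ¬ lvl1Zero x m

/-- The directed graph `K₃` on `X₃`: `(x,y)` is connected to `(x',y')` iff `x' = x`,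
`T^x(⟨⟩) = 0`, and for the least `n` with `T^x(n) = 1`, `y` and `y'` agree except
at `n`, with `y(n) = 0` and `y'(n) = 1`. -/
def K3Edge (a b : XThree) : Prop :=
  b.1 = a.1 ∧ rootZero a.1 ∧
  ∃ n : ℕ, ¬ lvl1Zero a.1 n ∧ (∀ m < n, lvl1Zero a.1 m) ∧
    a.2 n = false ∧ b.2 n = true ∧ ∀ m : ℕ, m ≠ n → a.2 m = b.2 m

/-- Membership in `W₃`, relative to a coding sequence `M`: for every finite
`m < n^x`, the number `k^x(m)` codes `(y(0),…,y(m))`, i.e. `M_{k^x(m)}` extends it. -/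
def memW3 (M : ℕ → ℕ → Bool) (a : XThree) : Prop :=
  ∀ m k : ℕ, (∀ m' ≤ m, lvl1Zero a.1 m') → ¬ lvl2Zero a.1 m k →
    (∀ k' < k, lvl2Zero a.1 m k') → ∀ i ≤ m, M k i = a.2 i

/-- `k^{x↾ℓ}(m)`: for the length-`ℓ` initial segment `t` of `x` (with respect to the
bijection `e : ℕ ≃ ℕ³`), the least `k` such that there is no `a` with `(m,k,a)` in
the domain of `t` and `t(m,k,a) = 1`. -/
noncomputable def kSeg (e : ℕ ≃ ℕ × ℕ × ℕ) (x : ℕ × ℕ × ℕ → Bool) (ℓ m : ℕ) : ℕ :=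
  sInf {k : ℕ | ¬ ∃ a : ℕ, e.symm (m, k, a) < ℓ ∧ x (m, k, a) = true}

open Classical in
/-- `n^{x↾ℓ}`: defined by recursion on `ℓ`, following the recursion defining `n^t`
for finite binary strings `t` (applied to the initial segments of `x`). -/
noncomputable def nSeg (e : ℕ ≃ ℕ × ℕ × ℕ) (x : ℕ × ℕ × ℕ → Bool) : ℕ → ℕ
  | 0 => 0
  | ℓ + 1 =>
    if ∃ m < nSeg e x ℓ, ∃ a : ℕ, e.symm (m, kSeg e x ℓ m, a) < ℓ + 1 ∧
        x (m, kSeg e x ℓ m, a) = true then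
      sInf {m : ℕ | m < nSeg e x ℓ ∧ ∃ a : ℕ, e.symm (m, kSeg e x ℓ m, a) < ℓ + 1 ∧
        x (m, kSeg e x ℓ m, a) = true}
    else nSeg e x ℓ + 1

/-- `n^x ∈ ℕ ∪ {∞}`: the supremum of the set of `n` such that `T^x(m) = 0` for
all `m < n`. -/
noncomputable def nVal (x : ℕ × ℕ × ℕ → Bool) : ℕ∞ :=
  sSup {N : ℕ∞ | ∃ n : ℕ, N = (n : ℕ∞) ∧ ∀ m < n, lvl1Zero x m}

/-- `k^x(m)`: the least `k` with `T^x(m,k) = 1`. -/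
noncomputable def kVal (x : ℕ × ℕ × ℕ → Bool) (m : ℕ) : ℕ :=
  sInf {k : ℕ | ¬ lvl2Zero x m k}

/-- `(x↾ℓ) ⊑_m x`: the length-`ℓ` initial segment `s` of `x` satisfies `m ≤ n^s`,
`m ≤ n^x`, and `k^s(j) = k^x(j)` for all `j < m`. -/
def sqSub (e : ℕ ≃ ℕ × ℕ × ℕ) (x : ℕ × ℕ × ℕ → Bool) (m ℓ : ℕ) : Prop :=
  m ≤ nSeg e x ℓ ∧ (m : ℕ∞) ≤ nVal x ∧ ∀ j < m, kSeg e x ℓ j = kVal x j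

/-- `c^x(m)`: the least length of an initial segment `s` of `x` with `s ⊑_m x`. -/
noncomputable def cVal (e : ℕ ≃ ℕ × ℕ × ℕ) (x : ℕ × ℕ × ℕ → Bool) (m : ℕ) : ℕ :=
  sInf {ℓ : ℕ | sqSub e x m ℓ}

/-- Membership in `Y₃`: for every finite `m < n^x`, the number `k^x(m)` codes the
string `(y(0),…,y(c^x(m)))`, i.e. `M_{k^x(m)}` extends it. -/
def memY3 (e : ℕ ≃ ℕ × ℕ × ℕ) (M : ℕ → ℕ → Bool) (a : XThree) : Prop :=
  ∀ m : ℕ, (m : ℕ∞) < nVal a.1 → ∀ i ≤ cVal e a.1 m, M (kVal a.1 m) i = a.2 i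

/-- The directed graph `H₃` on `X₃`: `(x,y)` is connected to `(x',y')` iff both are
in `Y₃`, `x' = x`, `n^x` is finite, and `y, y'` agree except at `c^x(n^x)`, with
`y(c^x(n^x)) = 0` and `y'(c^x(n^x)) = 1`. -/
def H3Edge (e : ℕ ≃ ℕ × ℕ × ℕ) (M : ℕ → ℕ → Bool) (a b : XThree) : Prop :=
  memY3 e M a ∧ memY3 e M b ∧ b.1 = a.1 ∧
  ∃ n : ℕ, nVal a.1 = (n : ℕ∞) ∧
    a.2 (cVal e a.1 n) = false ∧ b.2 (cVal e a.1 n) = true ∧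
    ∀ i : ℕ, i ≠ cVal e a.1 n → a.2 i = b.2 i

/-- The classes `Σ^0_β` of subsets of a topological space, defined by transfinite
recursion: `Σ^0_1` is the class of open sets, and for `β > 1`, a set is `Σ^0_β`
iff it is a countable union of complements of sets in classes `Σ^0_γ`, `1 ≤ γ < β`. -/
inductive SigmaClass (X : Type*) [TopologicalSpace X] : Ordinal → Set X → Prop
  | open_ (s : Set X) (hs : IsOpen s) : SigmaClass X 1 s
  | union (β : Ordinal) (γ : ℕ → Ordinal) (s : ℕ → Set X)
      (hβ : 1 < β) (hγ1 : ∀ n : ℕ, 1 ≤ γ n) (hγ : ∀ n : ℕ, γ n < β)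
      (hs : ∀ n : ℕ, SigmaClass X (γ n) (s n)) :
      SigmaClass X β (⋃ n : ℕ, (s n)ᶜ)

section Ideal

variable {X : Type*} [TopologicalSpace X] {P : Type*}

/-- `A` is covered by countably many `G`-independent `G_δ` sets. -/
def GdeltaSmall (G : Set (X × X)) (A : Set X) : Prop :=
  ∃ C : ℕ → Set X, (∀ n, IsGδ (C n) ∧ ∀ a ∈ C n, ∀ b ∈ C n, (a, b) ∉ G) ∧ A ⊆ ⋃ n, C n

theorem GdeltaSmall.mono {G : Set (X × X)} {A B : Set X} (h : GdeltaSmall G B) (hAB : A ⊆ B) :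
    GdeltaSmall G A := by
  obtain ⟨C, hC, hB⟩ := h
  exact ⟨C, hC, hAB.trans hB⟩

theorem GdeltaSmall.iUnion {G : Set (X × X)} {A : ℕ → Set X} (h : ∀ n, GdeltaSmall G (A n)) :
    GdeltaSmall G (⋃ n, A n) := by
  choose C hC hA using h
  refine ⟨fun n => C n.unpair.1 n.unpair.2, fun n => hC _ _, ?_⟩
  refine Set.iUnion_subset fun i a ha => ?_
  obtain ⟨j, hj⟩ := Set.mem_iUnion.1 (hA i ha)
  exact Set.mem_iUnion.2 ⟨Nat.pair i j, by simpa using hj⟩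

theorem GdeltaSmall.of_indep {G : Set (X × X)} {A : Set X} (hA : IsGδ A)
    (h : ∀ a ∈ A, ∀ b ∈ A, (a, b) ∉ G) : GdeltaSmall G A :=
  ⟨fun _ => A, fun _ => ⟨hA, h⟩, fun _ ha => Set.mem_iUnion.2 ⟨0, ha⟩⟩

theorem GdeltaSmall.union {G : Set (X × X)} {A B : Set X} (hA : GdeltaSmall G A)
    (hB : GdeltaSmall G B) : GdeltaSmall G (A ∪ B) := by
  refine (GdeltaSmall.iUnion (A := fun n : ℕ => if n = 0 then A else B) fun n => ?_).mono ?_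
  · split_ifs
    · exact hA
    · exact hB
  · rintro a (ha | ha)
    · exact Set.mem_iUnion.2 ⟨0, by simpa using ha⟩
    · exact Set.mem_iUnion.2 ⟨1, by simpa using ha⟩

/-- The source (`b = false`) or target (`b = true`) of the edge `φ z`. -/
def endpoint (φ : P → X × X) (b : Bool) (z : P) : X := bif b then (φ z).2 else (φ z).1

theorem continuous_endpoint [TopologicalSpace P] {φ : P → X × X} (hφ : Continuous φ) (b : Bool) :
    Continuous (endpoint φ b) := by
  cases b
  · exact continuous_fst.comp hφ
  · exact continuous_snd.comp hφ

/-- A nonempty set of edge codes such that the endpoints of each nonempty relatively open part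
have a closure which is not `GdeltaSmall`. -/
def EdgeLarge [TopologicalSpace P] (G : Set (X × X)) (φ : P → X × X) (Q : Set P) : Prop :=
  Q.Nonempty ∧ ∀ O : Set P, IsOpen O → (O ∩ Q).Nonempty → ∀ b : Bool,
    ¬ GdeltaSmall G (closure (endpoint φ b '' (O ∩ Q)))

theorem EdgeLarge.inter_open [TopologicalSpace P] {G : Set (X × X)} {φ : P → X × X} {Q O : Set P}
    (h : EdgeLarge G φ Q) (hO : IsOpen O) (hne : (O ∩ Q).Nonempty) : EdgeLarge G φ (O ∩ Q) := by
  refine ⟨hne, fun O' hO' hne' b => ?_⟩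
  rw [← Set.inter_assoc] at hne' ⊢
  exact h.2 _ (hO'.inter hO) hne' b

theorem EdgeLarge.not_small [TopologicalSpace P] {G : Set (X × X)} {φ : P → X × X} {Q : Set P}
    (h : EdgeLarge G φ Q) (b : Bool) : ¬ GdeltaSmall G (closure (endpoint φ b '' Q)) := by
  have := h.2 Set.univ isOpen_univ (by simpa using h.1) b
  simpa using this

/-- Every closed set which is not `GdeltaSmall` contains the endpoints of an `EdgeLarge` set. -/
theorem exists_edgeLarge [TopologicalSpace P] [SecondCountableTopology P] {G : Set (X × X)}
    {φ : P → X × X} (hφ : Set.range φ = G) {F : Set X} (hFδ : IsGδ F)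
    (hFs : ¬ GdeltaSmall G F) :
    ∃ Q : Set P, EdgeLarge G φ Q ∧ ∀ z ∈ Q, ∀ b, endpoint φ b z ∈ F := by
  let Neg : Set P → Prop := fun Z => ∃ S : ℕ → Set X,
    (∀ i, IsClosed (S i) ∧ GdeltaSmall G (S i)) ∧ ∀ z ∈ Z, ∃ b i, endpoint φ b z ∈ S i
  have neg_mono : ∀ {Z W : Set P}, Neg W → Z ⊆ W → Neg Z := fun ⟨S, hS, h⟩ hZW =>
    ⟨S, hS, fun z hz => h z (hZW hz)⟩
  have neg_iUnion : ∀ {Z : ℕ → Set P}, (∀ n, Neg (Z n)) → Neg (⋃ n, Z n) := by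
    intro Z h
    choose S hS hZ using h
    refine ⟨fun n => S n.unpair.1 n.unpair.2, fun n => hS _ _, fun z hz => ?_⟩
    obtain ⟨n, hn⟩ := Set.mem_iUnion.1 hz
    obtain ⟨b, i, hi⟩ := hZ n z hn
    exact ⟨b, Nat.pair n i, by simpa using hi⟩
  have neg_closed : ∀ {Z : Set P} (b : Bool), GdeltaSmall G (closure (endpoint φ b '' Z)) →
      Neg Z := fun {Z} b h =>
    ⟨fun _ => closure (endpoint φ b '' Z), fun _ => ⟨isClosed_closure, h⟩,
      fun z hz => ⟨b, 0, subset_closure ⟨z, hz, rfl⟩⟩⟩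
  have neg_empty : Neg ∅ :=
    ⟨fun _ => ∅, fun _ => ⟨isClosed_empty, .of_indep .empty (by simp)⟩, by simp⟩
  let K₀ : Set P := {z | ∀ b, endpoint φ b z ∈ F}
  let ℬ := {O ∈ TopologicalSpace.countableBasis P | Neg (O ∩ K₀)}
  have hℬ : ℬ.Countable := (TopologicalSpace.countable_countableBasis P).mono (Set.sep_subset _ _)
  have hU : Neg (⋃₀ ℬ ∩ K₀) := by
    rcases ℬ.eq_empty_or_nonempty with h | h
    · simpa [h] using neg_empty
    · obtain ⟨O, hO⟩ := hℬ.exists_eq_range h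
      refine neg_mono (neg_iUnion (Z := fun n => O n ∩ K₀) fun n => ?_) ?_
      · have : O n ∈ ℬ := hO ▸ Set.mem_range_self n
        exact this.2
      · rw [hO, Set.sUnion_range, Set.iUnion_inter]
  refine ⟨K₀ \ ⋃₀ ℬ, ⟨?_, ?_⟩, fun z hz => hz.1⟩
  · by_contra hne
    rw [Set.not_nonempty_iff_eq_empty, Set.sdiff_eq_empty] at hne
    obtain ⟨S, hS, hcov⟩ := neg_mono hU (Set.subset_inter hne subset_rfl)
    refine hFs (((GdeltaSmall.iUnion fun i => (hS i).2).union
      (.of_indep (A := F ∩ ⋂ i, (S i)ᶜ) ?_ ?_)).mono ?_)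
    · exact hFδ.inter (.iInter_of_isOpen fun i => (hS i).1.isOpen_compl)
    · rintro a ⟨ha, ha'⟩ b ⟨hb, hb'⟩ hab
      obtain ⟨z, hz⟩ := hφ.symm ▸ hab
      obtain ⟨s, i, hi⟩ := hcov z (by rintro (_ | _) <;> simpa [endpoint, hz])
      rw [Set.mem_iInter] at ha' hb'
      cases s
      · exact ha' i (by simpa [endpoint, hz] using hi)
      · exact hb' i (by simpa [endpoint, hz] using hi)
    · intro a ha
      by_cases h : a ∈ ⋃ i, S i
      · exact Or.inl h
      · exact Or.inr ⟨ha, by simpa using h⟩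
  · rintro O hO ⟨z, hzO, hz⟩ b hsmall
    obtain ⟨B, hB, hzB, hBO⟩ :=
      (TopologicalSpace.isBasis_countableBasis P).exists_subset_of_mem_open hzO hO
    refine hz.2 ⟨B, ⟨hB, ?_⟩, hzB⟩
    have h := neg_iUnion (Z := fun n : ℕ => if n = 0 then O ∩ (K₀ \ ⋃₀ ℬ) else ⋃₀ ℬ ∩ K₀)
      fun n => by
        split_ifs
        · exact neg_closed b hsmall
        · exact hU
    refine neg_mono h fun w hw => Set.mem_iUnion.2 ?_
    by_cases hwU : w ∈ ⋃₀ ℬ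
    · exact ⟨1, by simpa using ⟨hwU, hw.2⟩⟩
    · exact ⟨0, by simpa using ⟨hBO hw.1, hw.2, by simpa using hwU⟩⟩

end Ideal

section Fine

variable {X P : Type*} [MetricSpace X] [MetricSpace P]

/-- `Q`, and the sets of sources and of targets of its edges, have diameter at most `ε`. -/
def FineSet (φ : P → X × X) (ε : ℝ) (Q : Set P) : Prop :=
  ∀ z ∈ Q, ∀ w ∈ Q, dist z w ≤ ε ∧ ∀ b, dist (endpoint φ b z) (endpoint φ b w) ≤ ε

theorem EdgeLarge.exists_fine {G : Set (X × X)} {φ : P → X × X} (hφ : Continuous φ) {Q : Set P}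
    (hQ : EdgeLarge G φ Q) {z : P} (hz : z ∈ Q) {ε : ℝ} (hε : 0 < ε) :
    ∃ Q' ⊆ Q, EdgeLarge G φ Q' ∧ FineSet φ ε Q' ∧
      ∀ w ∈ Q', ∀ b, dist (endpoint φ b w) (endpoint φ b z) < ε / 2 := by
  let O : Set P := Metric.ball z (ε / 2) ∩
    ⋂ b, endpoint φ b ⁻¹' Metric.ball (endpoint φ b z) (ε / 2)
  have hO : IsOpen O := Metric.isOpen_ball.inter
    (isOpen_iInter_of_finite fun b => Metric.isOpen_ball.preimage (continuous_endpoint hφ b))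
  have hzO : z ∈ O := by simp [O, hε]
  have hOb : ∀ w ∈ O, ∀ b, dist (endpoint φ b w) (endpoint φ b z) < ε / 2 := fun w hw b =>
    Set.mem_iInter.1 hw.2 b
  refine ⟨O ∩ Q, Set.inter_subset_right, hQ.inter_open hO ⟨z, hzO, hz⟩, ?_,
    fun w hw => hOb w hw.1⟩
  intro u hu w hw
  have h₁ : dist u z < ε / 2 := hu.1.1
  have h₂ : dist w z < ε / 2 := hw.1.1
  refine ⟨by linarith [dist_triangle_right u w z], fun b => ?_⟩
  linarith [dist_triangle_right (endpoint φ b u) (endpoint φ b w) (endpoint φ b z),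
    hOb u hu.1 b, hOb w hw.1 b]

/-- A choice of a fine `EdgeLarge` set of edges inside `F`. -/
noncomputable def freshEdges (G : Set (X × X)) (φ : P → X × X) (F : Set X) (ε : ℝ) : Set P :=
  Classical.epsilon fun Q => EdgeLarge G φ Q ∧ FineSet φ ε Q ∧ ∀ z ∈ Q, ∀ b, endpoint φ b z ∈ F

theorem freshEdges_spec [SecondCountableTopology P] {G : Set (X × X)} {φ : P → X × X}
    (hφ : Continuous φ) (hφG : Set.range φ = G) {F : Set X} (hF : IsClosed F)
    (hFs : ¬ GdeltaSmall G F) {ε : ℝ} (hε : 0 < ε) :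
    EdgeLarge G φ (freshEdges G φ F ε) ∧ FineSet φ ε (freshEdges G φ F ε) ∧
      ∀ z ∈ freshEdges G φ F ε, ∀ b, endpoint φ b z ∈ F := by
  refine Classical.epsilon_spec (p := fun Q => EdgeLarge G φ Q ∧ FineSet φ ε Q ∧
    ∀ z ∈ Q, ∀ b, endpoint φ b z ∈ F) ?_
  obtain ⟨Q, hQ, hQF⟩ := exists_edgeLarge hφG hF.isGδ hFs
  obtain ⟨z, hz⟩ := hQ.1
  obtain ⟨Q', hQ', h₁, h₂, -⟩ := hQ.exists_fine hφ hz hε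
  exact ⟨Q', h₁, h₂, fun w hw => hQF w (hQ' hw)⟩

/-- A choice of a fine `EdgeLarge` subset of `Q` with endpoints on side `b` close to `p`. -/
noncomputable def shrinkEdges (G : Set (X × X)) (φ : P → X × X) (Q : Set P) (b : Bool) (p : X)
    (ε : ℝ) : Set P :=
  Classical.epsilon fun Q' => Q' ⊆ Q ∧ EdgeLarge G φ Q' ∧ FineSet φ ε Q' ∧
    ∀ z ∈ Q', dist (endpoint φ b z) p ≤ ε

theorem shrinkEdges_spec {G : Set (X × X)} {φ : P → X × X} (hφ : Continuous φ) {Q : Set P}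
    (hQ : EdgeLarge G φ Q) {b : Bool} {p : X} (hp : p ∈ closure (endpoint φ b '' Q)) {ε : ℝ}
    (hε : 0 < ε) :
    shrinkEdges G φ Q b p ε ⊆ Q ∧ EdgeLarge G φ (shrinkEdges G φ Q b p ε) ∧
      FineSet φ ε (shrinkEdges G φ Q b p ε) ∧
      ∀ z ∈ shrinkEdges G φ Q b p ε, dist (endpoint φ b z) p ≤ ε := by
  refine Classical.epsilon_spec (p := fun Q' => Q' ⊆ Q ∧ EdgeLarge G φ Q' ∧ FineSet φ ε Q' ∧
    ∀ z ∈ Q', dist (endpoint φ b z) p ≤ ε) ?_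
  obtain ⟨_, ⟨z, hz, rfl⟩, hzp⟩ := Metric.mem_closure_iff.1 hp (ε / 2) (by positivity)
  obtain ⟨Q', hQ', h₁, h₂, h₃⟩ := hQ.exists_fine hφ hz hε
  refine ⟨Q', hQ', h₁, h₂, fun w hw => ?_⟩
  rw [dist_comm] at hzp
  linarith [dist_triangle (endpoint φ b w) (endpoint φ b z) p, h₃ w hw b]

end Fine

section State

/-- The laws satisfied by the guesses along the finite initial segments of a point of `2^{ℕ³}`:
`n ℓ` is the guessed length, `k ℓ j` the guessed witnesses, and `c ℓ j` the stage at which the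
current guess at level `j` was made. -/
structure IsGuess (n : ℕ → ℕ) (k c : ℕ → ℕ → ℕ) : Prop where
  n_zero : n 0 = 0
  k_mono : ∀ j, Monotone fun ℓ => k ℓ j
  step : ∀ ℓ, (n (ℓ + 1) < n ℓ ∧ k ℓ (n (ℓ + 1)) < k (ℓ + 1) (n (ℓ + 1))) ∨ n (ℓ + 1) = n ℓ + 1
  k_eq : ∀ ℓ j, j < n ℓ → j < n (ℓ + 1) → k (ℓ + 1) j = k ℓ j
  c_zero : ∀ j, c 0 j = 0
  c_succ : ∀ ℓ j, c (ℓ + 1) j = if j = n (ℓ + 1) ∧ n ℓ < n (ℓ + 1) then ℓ + 1 else c ℓ j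

namespace IsGuess

variable {n : ℕ → ℕ} {k c : ℕ → ℕ → ℕ}

theorem c_le (h : IsGuess n k c) (ℓ j : ℕ) : c ℓ j ≤ ℓ := by
  induction ℓ with
  | zero => simp [h.c_zero]
  | succ ℓ ih =>
    rw [h.c_succ]
    split_ifs
    · exact le_rfl
    · omega

theorem c_eq (h : IsGuess n k c) {ℓ j : ℕ} (hj : j ≤ n ℓ) : c (ℓ + 1) j = c ℓ j := by
  rw [h.c_succ, if_neg]
  omega

end IsGuess


variable {X P : Type*} [MetricSpace X] [MetricSpace P] [Nonempty P]

/-- The stack of sets of edge codes kept for `y` at stage `ℓ`; the levels `j ≤ n ℓ` matter. -/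
noncomputable def edgeState (G : Set (X × X)) (φ : P → X × X) (M : ℕ → ℕ → Bool) (n : ℕ → ℕ)
    (k c : ℕ → ℕ → ℕ) : ℕ → (ℕ → Bool) → ℕ → Set P
  | 0, _, _ => freshEdges G φ Set.univ 1
  | ℓ + 1, y, j =>
    if j = n (ℓ + 1) then
      if n ℓ < n (ℓ + 1) then
        freshEdges G φ
          (closure (endpoint φ (y (c ℓ (n ℓ))) '' edgeState G φ M n k c ℓ y (n ℓ)))
          ((1 / 2) ^ (ℓ + 1))
      else
        let y' := Function.update y (c ℓ j) (M (k ℓ j) (c ℓ j))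
        shrinkEdges G φ (edgeState G φ M n k c ℓ y' j) (M (k ℓ j) (c ℓ j))
          (endpoint φ (y' (c ℓ (n ℓ)))
            (Classical.epsilon fun z => z ∈ edgeState G φ M n k c ℓ y' (n ℓ)))
          ((1 / 2) ^ (ℓ + 1))
    else edgeState G φ M n k c ℓ y j

/-- The stage `ℓ` approximation of the image of `y`. -/
noncomputable def edgePoint (G : Set (X × X)) (φ : P → X × X) (M : ℕ → ℕ → Bool) (n : ℕ → ℕ)
    (k c : ℕ → ℕ → ℕ) (ℓ : ℕ) (y : ℕ → Bool) : X :=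
  endpoint φ (y (c ℓ (n ℓ))) (Classical.epsilon fun z => z ∈ edgeState G φ M n k c ℓ y (n ℓ))

variable {G : Set (X × X)} {φ : P → X × X} {M : ℕ → ℕ → Bool} {n n' : ℕ → ℕ}
  {k c k' c' : ℕ → ℕ → ℕ}

theorem edgeState_push {ℓ : ℕ} (hn : n ℓ < n (ℓ + 1)) (y : ℕ → Bool) :
    edgeState G φ M n k c (ℓ + 1) y (n (ℓ + 1)) = freshEdges G φ
      (closure (endpoint φ (y (c ℓ (n ℓ))) '' edgeState G φ M n k c ℓ y (n ℓ)))
      ((1 / 2) ^ (ℓ + 1)) := by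
  rw [edgeState, if_pos rfl, if_pos hn]

theorem edgeState_pop {ℓ m : ℕ} (hm : n (ℓ + 1) = m) (hn : m < n ℓ) (y : ℕ → Bool) :
    edgeState G φ M n k c (ℓ + 1) y m =
      shrinkEdges G φ
        (edgeState G φ M n k c ℓ (Function.update y (c ℓ m) (M (k ℓ m) (c ℓ m))) m)
        (M (k ℓ m) (c ℓ m))
        (edgePoint G φ M n k c ℓ (Function.update y (c ℓ m) (M (k ℓ m) (c ℓ m))))
        ((1 / 2) ^ (ℓ + 1)) := by
  rw [edgeState, if_pos hm.symm, if_neg (by omega)]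
  rfl

theorem edgeState_of_ne {ℓ j : ℕ} (hj : j ≠ n (ℓ + 1)) (y : ℕ → Bool) :
    edgeState G φ M n k c (ℓ + 1) y j = edgeState G φ M n k c ℓ y j := by
  rw [edgeState, if_neg hj]

theorem edgeState_congr_guess {ℓ : ℕ} (hn : ∀ t ≤ ℓ, n t = n' t) (hk : ∀ t ≤ ℓ, k t = k' t)
    (hc : ∀ t ≤ ℓ, c t = c' t) :
    edgeState G φ M n k c ℓ = edgeState G φ M n' k' c' ℓ := by
  induction ℓ with
  | zero => rfl
  | succ ℓ ih =>
    have ih' := ih (fun t ht => hn t (by omega)) (fun t ht => hk t (by omega))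
      (fun t ht => hc t (by omega))
    funext y j
    simp only [edgeState, ih', hn (ℓ + 1) le_rfl, hn ℓ (by omega), hk ℓ (by omega),
      hc ℓ (by omega)]

theorem IsGuess.edgeState_congr (h : IsGuess n k c) {ℓ j : ℕ} (hj : j ≤ n ℓ) {y y' : ℕ → Bool}
    (hy : ∀ i ≤ ℓ, i ≠ c ℓ j → y i = y' i) :
    ∀ i ≤ j, edgeState G φ M n k c ℓ y i = edgeState G φ M n k c ℓ y' i := by
  induction ℓ generalizing j y y' with
  | zero => intro i _; rfl
  | succ ℓ ih =>
    have ih_all : ∀ {y y' : ℕ → Bool}, (∀ i ≤ ℓ, y i = y' i) → ∀ i ≤ n ℓ,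
        edgeState G φ M n k c ℓ y i = edgeState G φ M n k c ℓ y' i :=
      fun hyy => ih le_rfl fun i hi _ => hyy i hi
    rcases h.step ℓ with ⟨hlt, -⟩ | hpush
    · rw [h.c_eq (by omega)] at hy
      intro i hi
      have ih_i : ∀ i ≤ j, edgeState G φ M n k c ℓ y i = edgeState G φ M n k c ℓ y' i :=
        ih (by omega) fun i hi => hy i (by omega)
      by_cases hin : i = n (ℓ + 1)
      · have hji : j = i := by omega
        subst hji
        have hyy : ∀ i ≤ ℓ, Function.update y (c ℓ j) (M (k ℓ j) (c ℓ j)) i =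
            Function.update y' (c ℓ j) (M (k ℓ j) (c ℓ j)) i := by
          intro i hi
          by_cases hic : i = c ℓ j
          · simp [hic]
          · simp [hic, hy i (by omega) hic]
        rw [edgeState_pop hin.symm (by omega), edgeState_pop hin.symm (by omega), edgePoint,
          edgePoint, ih_all hyy j (by omega), ih_all hyy (n ℓ) le_rfl, hyy _ (h.c_le _ _)]
      · rw [edgeState_of_ne hin, edgeState_of_ne hin, ih_i i hi]
    · by_cases hjn : j = n (ℓ + 1)
      · subst hjn
        have hcc : c (ℓ + 1) (n (ℓ + 1)) = ℓ + 1 := by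
          rw [h.c_succ, if_pos ⟨rfl, by omega⟩]
        have hyy : ∀ i ≤ ℓ, y i = y' i := fun i hi => hy i (by omega) (by omega)
        intro i hi
        by_cases hin : i = n (ℓ + 1)
        · subst hin
          rw [edgeState_push (by omega), edgeState_push (by omega), ih_all hyy _ le_rfl,
            hyy _ (h.c_le _ _)]
        · rw [edgeState_of_ne hin, edgeState_of_ne hin, ih_all hyy i (by omega)]
      · have hjn' : j ≤ n ℓ := by omega
        rw [h.c_eq hjn'] at hy
        intro i hi
        have hin : i ≠ n (ℓ + 1) := by omega
        rw [edgeState_of_ne hin, edgeState_of_ne hin,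
          ih hjn' (fun i hi => hy i (by omega)) i hi]

/-- The invariants of the stack kept for `y` at stage `ℓ`. -/
structure StateInv (G : Set (X × X)) (φ : P → X × X) (M : ℕ → ℕ → Bool) (n : ℕ → ℕ)
    (k c : ℕ → ℕ → ℕ) (ℓ : ℕ) (y : ℕ → Bool) : Prop where
  large : ∀ j ≤ n ℓ, EdgeLarge G φ (edgeState G φ M n k c ℓ y j)
  fine : FineSet φ ((1 / 2) ^ ℓ) (edgeState G φ M n k c ℓ y (n ℓ))
  chain : ∀ j < n ℓ, ∀ z ∈ edgeState G φ M n k c ℓ y (j + 1), ∀ b,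
    endpoint φ b z ∈ closure (endpoint φ (y (c ℓ j)) '' edgeState G φ M n k c ℓ y j)

theorem StateInv.closure_subset {ℓ : ℕ} {y : ℕ → Bool} (hI : StateInv G φ M n k c ℓ y) {i j : ℕ}
    (hij : i ≤ j) (hj : j ≤ n ℓ) :
    closure (endpoint φ (y (c ℓ j)) '' edgeState G φ M n k c ℓ y j) ⊆
      closure (endpoint φ (y (c ℓ i)) '' edgeState G φ M n k c ℓ y i) := by
  induction j, hij using Nat.le_induction with
  | base => rfl
  | succ j _ ih =>
    refine (closure_minimal ?_ isClosed_closure).trans (ih (by omega))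
    rintro _ ⟨z, hz, rfl⟩
    exact hI.chain j (by omega) z hz _

theorem StateInv.epsilon_mem {ℓ : ℕ} {y : ℕ → Bool} (hI : StateInv G φ M n k c ℓ y) :
    (Classical.epsilon fun z => z ∈ edgeState G φ M n k c ℓ y (n ℓ)) ∈
      edgeState G φ M n k c ℓ y (n ℓ) :=
  Classical.epsilon_spec (p := fun z => z ∈ edgeState G φ M n k c ℓ y (n ℓ))
    (hI.large _ le_rfl).1

theorem StateInv.edgePoint_mem {ℓ : ℕ} {y : ℕ → Bool} (hI : StateInv G φ M n k c ℓ y) {j : ℕ}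
    (hj : j ≤ n ℓ) :
    edgePoint G φ M n k c ℓ y ∈
      closure (endpoint φ (y (c ℓ j)) '' edgeState G φ M n k c ℓ y j) :=
  hI.closure_subset hj le_rfl (subset_closure ⟨_, hI.epsilon_mem, rfl⟩)

theorem IsGuess.edgeState_update (h : IsGuess n k c) {ℓ m : ℕ} (hm : m ≤ n ℓ) (y : ℕ → Bool)
    (b : Bool) : edgeState G φ M n k c ℓ (Function.update y (c ℓ m) b) m =
      edgeState G φ M n k c ℓ y m :=
  h.edgeState_congr hm (fun i _ hi => by simp [hi]) m le_rfl

/-- What happens to the stack when the guessed length drops to `m`. -/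
theorem StateInv.pop_spec (h : IsGuess n k c) (hφ : Continuous φ) {ℓ m : ℕ}
    (hI : ∀ y, StateInv G φ M n k c ℓ y) (hm : n (ℓ + 1) = m) (hn : m < n ℓ) (y : ℕ → Bool) :
    edgeState G φ M n k c (ℓ + 1) y m ⊆ edgeState G φ M n k c ℓ y m ∧
      EdgeLarge G φ (edgeState G φ M n k c (ℓ + 1) y m) ∧
      FineSet φ ((1 / 2) ^ (ℓ + 1)) (edgeState G φ M n k c (ℓ + 1) y m) ∧
      ∀ z ∈ edgeState G φ M n k c (ℓ + 1) y m, dist (endpoint φ (M (k ℓ m) (c ℓ m)) z)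
        (edgePoint G φ M n k c ℓ (Function.update y (c ℓ m) (M (k ℓ m) (c ℓ m)))) ≤
          (1 / 2) ^ (ℓ + 1) := by
  rw [edgeState_pop hm hn, h.edgeState_update hn.le]
  refine shrinkEdges_spec hφ ((hI y).large m hn.le) ?_ (by positivity)
  have := (hI (Function.update y (c ℓ m) (M (k ℓ m) (c ℓ m)))).edgePoint_mem hn.le
  rwa [h.edgeState_update hn.le, Function.update_self] at this

theorem stateInv [SecondCountableTopology P] (h : IsGuess n k c) (hφ : Continuous φ)
    (hφG : Set.range φ = G) (hG : ¬ GdeltaSmall G Set.univ) (ℓ : ℕ) (y : ℕ → Bool) :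
    StateInv G φ M n k c ℓ y := by
  induction ℓ generalizing y with
  | zero =>
    obtain ⟨h₁, h₂, -⟩ := freshEdges_spec hφ hφG isClosed_univ hG one_pos
    exact ⟨fun j _ => h₁, by simpa [edgeState] using h₂, fun j hj => by simp [h.n_zero] at hj⟩
  | succ ℓ ih =>
    rcases h.step ℓ with ⟨hlt, -⟩ | hpush
    · obtain ⟨h₁, h₂, h₃, -⟩ := StateInv.pop_spec h hφ ih rfl hlt y
      refine ⟨fun j hj => ?_, h₃, fun j hj z hz b => ?_⟩
      · rcases hj.eq_or_lt with rfl | hj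
        · exact h₂
        · rw [edgeState_of_ne hj.ne]
          exact (ih y).large j (by omega)
      · rw [edgeState_of_ne hj.ne, h.c_eq (by omega)]
        refine (ih y).chain j (by omega) z ?_ b
        by_cases hj' : j + 1 = n (ℓ + 1)
        · rw [hj'] at hz ⊢
          exact h₁ hz
        · rwa [edgeState_of_ne hj'] at hz
    · obtain ⟨h₁, h₂, h₃⟩ := freshEdges_spec hφ hφG isClosed_closure
        (((ih y).large (n ℓ) le_rfl).not_small (y (c ℓ (n ℓ))))
        (ε := (1 / 2) ^ (ℓ + 1)) (by positivity)
      rw [← edgeState_push (by omega)] at h₁ h₂ h₃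
      refine ⟨fun j hj => ?_, h₂, fun j hj z hz b => ?_⟩
      · rcases hj.eq_or_lt with rfl | hj
        · exact h₁
        · rw [edgeState_of_ne hj.ne]
          exact (ih y).large j (by omega)
      · rw [edgeState_of_ne hj.ne, h.c_eq (by omega)]
        by_cases hj' : j + 1 = n (ℓ + 1)
        · obtain rfl : j = n ℓ := by omega
          rw [hj'] at hz
          exact h₃ z hz b
        · rw [edgeState_of_ne hj'] at hz
          exact (ih y).chain j (by omega) z hz b

/-- The guesses at stage `ℓ` about the bits of `y` at which edges are placed are correct. -/
def BitsCoded (M : ℕ → ℕ → Bool) (n : ℕ → ℕ) (k c : ℕ → ℕ → ℕ) (ℓ : ℕ) (y : ℕ → Bool) : Prop :=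
  ∀ j < n ℓ, M (k ℓ j) (c ℓ j) = y (c ℓ j)

theorem BitsCoded.dist_edgePoint_le (h : IsGuess n k c) (hφ : Continuous φ)
    (hI : ∀ ℓ y, StateInv G φ M n k c ℓ y) {ℓ₀ : ℕ} {y : ℕ → Bool}
    (hy : BitsCoded M n k c ℓ₀ y) {ℓ : ℕ} (hℓ : ℓ₀ ≤ ℓ) :
    dist (edgePoint G φ M n k c ℓ y) (edgePoint G φ M n k c ℓ₀ y) ≤ 2 * (1 / 2) ^ ℓ₀ := by
  have close : ∀ {ℓ m : ℕ} {r : ℝ}, m ≤ n ℓ →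
      (∀ z ∈ edgeState G φ M n k c ℓ y m,
        dist (endpoint φ (y (c ℓ m)) z) (edgePoint G φ M n k c ℓ₀ y) ≤ r) →
      dist (edgePoint G φ M n k c ℓ y) (edgePoint G φ M n k c ℓ₀ y) ≤ r := by
    intro ℓ m r hm hz
    have := (closure_minimal (t := Metric.closedBall (edgePoint G φ M n k c ℓ₀ y) r) (by
      rintro _ ⟨z, hz', rfl⟩
      exact hz z hz') Metric.isClosed_closedBall) ((hI ℓ y).edgePoint_mem hm)
    exact this
  suffices H : ∃ m ≤ n ℓ₀, m ≤ n ℓ ∧ (∀ j < m, k ℓ j = k ℓ₀ j) ∧ (∀ j ≤ m, c ℓ j = c ℓ₀ j) ∧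
      ∀ z ∈ edgeState G φ M n k c ℓ y m,
        dist (endpoint φ (y (c ℓ m)) z) (edgePoint G φ M n k c ℓ₀ y) ≤
          2 * (1 / 2) ^ ℓ₀ - (1 / 2) ^ ℓ by
    obtain ⟨m, -, hm, -, -, hz⟩ := H
    have := close hm hz
    have : (0 : ℝ) < (1 / 2) ^ ℓ := by positivity
    linarith
  induction ℓ, hℓ using Nat.le_induction with
  | base =>
    refine ⟨n ℓ₀, le_rfl, le_rfl, fun _ _ => rfl, fun _ _ => rfl, fun z hz => ?_⟩
    have := ((hI ℓ₀ y).fine z hz _ (hI ℓ₀ y).epsilon_mem).2 (y (c ℓ₀ (n ℓ₀)))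
    change dist _ (edgePoint G φ M n k c ℓ₀ y) ≤ _ at this
    linarith
  | succ ℓ _ ih =>
    obtain ⟨m, hm₀, hm, hk, hc, hz⟩ := ih
    have hpow : ((1 : ℝ) / 2) ^ (ℓ + 1) = (1 / 2) ^ ℓ / 2 := by ring
    have hpos : (0 : ℝ) < (1 / 2) ^ ℓ := by positivity
    rcases lt_trichotomy m (n (ℓ + 1)) with hlt | heq | hgt
    · refine ⟨m, hm₀, hlt.le, fun j hj => ?_, fun j hj => ?_, fun z hz' => ?_⟩
      · rw [h.k_eq ℓ j (by omega) (by omega), hk j hj]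
      · rw [h.c_eq (by omega), hc j hj]
      · rw [edgeState_of_ne hlt.ne] at hz'
        rw [h.c_eq hm]
        linarith [hz z hz']
    · have hlt : m < n ℓ := by
        rcases h.step ℓ with h' | h' <;> omega
      refine ⟨m, hm₀, heq.le, fun j hj => ?_, fun j hj => ?_, fun z hz' => ?_⟩
      · rw [h.k_eq ℓ j (by omega) (by omega), hk j hj]
      · rw [h.c_eq (by omega), hc j hj]
      · rw [h.c_eq hm]
        linarith [hz z ((StateInv.pop_spec h hφ (hI ℓ) heq.symm hlt y).1 hz')]
    · refine ⟨n (ℓ + 1), by omega, le_rfl, fun j hj => ?_, fun j hj => ?_, fun z hz' => ?_⟩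
      · rw [h.k_eq ℓ j (by omega) (by omega), hk j (by omega)]
      · rw [h.c_eq (by omega), hc j (by omega)]
      · have hpop := (StateInv.pop_spec h hφ (hI ℓ) rfl (by omega) y).2.2.2 z hz'
        have hbit : M (k ℓ (n (ℓ + 1))) (c ℓ (n (ℓ + 1))) = y (c ℓ (n (ℓ + 1))) := by
          rw [hk _ hgt, hc _ hgt.le]
          exact hy _ (by omega)
        rw [hbit, Function.update_eq_self] at hpop
        rw [h.c_eq (by omega)]
        linarith [close hm hz, dist_triangle (endpoint φ (y (c ℓ (n (ℓ + 1)))) z)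
          (edgePoint G φ M n k c ℓ y) (edgePoint G φ M n k c ℓ₀ y)]


theorem exists_tendsto_edgePoint [CompleteSpace X] (h : IsGuess n k c) (hφ : Continuous φ)
    (hI : ∀ ℓ y, StateInv G φ M n k c ℓ y) {y : ℕ → Bool}
    (hy : ∀ N, ∃ ℓ ≥ N, BitsCoded M n k c ℓ y) :
    ∃ l, Filter.Tendsto (fun ℓ => edgePoint G φ M n k c ℓ y) Filter.atTop (nhds l) := by
  refine cauchySeq_tendsto_of_complete (Metric.cauchySeq_iff'.2 fun ε hε => ?_)
  obtain ⟨N, hN⟩ := exists_pow_lt_of_lt_one (half_pos hε) (one_half_lt_one (α := ℝ))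
  obtain ⟨ℓ, hℓ, hb⟩ := hy N
  refine ⟨ℓ, fun ℓ' hℓ' => (hb.dist_edgePoint_le h hφ hI hℓ').trans_lt ?_⟩
  have : ((1 : ℝ) / 2) ^ ℓ ≤ (1 / 2) ^ N :=
    pow_le_pow_of_le_one (by norm_num) (by norm_num) hℓ
  linarith

theorem BitsCoded.dist_limit_le (h : IsGuess n k c) (hφ : Continuous φ)
    (hI : ∀ ℓ y, StateInv G φ M n k c ℓ y) {ℓ₀ : ℕ} {y : ℕ → Bool}
    (hy : BitsCoded M n k c ℓ₀ y) {l : X}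
    (hl : Filter.Tendsto (fun ℓ => edgePoint G φ M n k c ℓ y) Filter.atTop (nhds l)) :
    dist l (edgePoint G φ M n k c ℓ₀ y) ≤ 2 * (1 / 2) ^ ℓ₀ :=
  le_of_tendsto (hl.dist tendsto_const_nhds)
    (Filter.eventually_atTop.2 ⟨ℓ₀, fun _ hℓ => hy.dist_edgePoint_le h hφ hI hℓ⟩)

theorem IsGuess.c_eq_of_le (h : IsGuess n k c) {ℓ₀ m : ℕ} (hm : ∀ ℓ ≥ ℓ₀, m ≤ n ℓ) {ℓ : ℕ}
    (hℓ : ℓ₀ ≤ ℓ) : c ℓ m = c ℓ₀ m := by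
  induction ℓ, hℓ using Nat.le_induction with
  | base => rfl
  | succ ℓ hℓ ih => rw [h.c_eq (hm ℓ hℓ), ih]

theorem edgeState_antitone (h : IsGuess n k c) (hφ : Continuous φ)
    (hI : ∀ ℓ y, StateInv G φ M n k c ℓ y) {ℓ₀ m : ℕ} (hm : ∀ ℓ ≥ ℓ₀, m ≤ n ℓ) {ℓ ℓ' : ℕ}
    (hℓ : ℓ₀ ≤ ℓ) (hℓ' : ℓ ≤ ℓ') (y : ℕ → Bool) :
    edgeState G φ M n k c ℓ' y m ⊆ edgeState G φ M n k c ℓ y m := by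
  induction ℓ', hℓ' using Nat.le_induction with
  | base => rfl
  | succ ℓ' hℓ' ih =>
    refine subset_trans ?_ ih
    by_cases hmn : m = n (ℓ' + 1)
    · have := hm ℓ' (by omega)
      exact (StateInv.pop_spec h hφ (hI ℓ') hmn.symm
        (by rcases h.step ℓ' with h' | h' <;> omega) y).1
    · rw [edgeState_of_ne hmn]

/-- If the guessed lengths have limit inferior `m`, then two points which differ exactly at the
bit for level `m` are sent to an edge. -/
theorem limit_edge [CompleteSpace P] (h : IsGuess n k c) (hφ : Continuous φ)
    (hφG : Set.range φ = G) (hI : ∀ ℓ y, StateInv G φ M n k c ℓ y) {ℓ₀ m : ℕ}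
    (hm : ∀ ℓ ≥ ℓ₀, m ≤ n ℓ) (hfreq : ∀ N, ∃ ℓ ≥ N, n ℓ = m) {y y' : ℕ → Bool}
    (hy : y (c ℓ₀ m) = false) (hy' : y' (c ℓ₀ m) = true) (hyy : ∀ i ≠ c ℓ₀ m, y i = y' i)
    {l l' : X}
    (hl : Filter.Tendsto (fun ℓ => edgePoint G φ M n k c ℓ y) Filter.atTop (nhds l))
    (hl' : Filter.Tendsto (fun ℓ => edgePoint G φ M n k c ℓ y') Filter.atTop (nhds l')) :
    (l, l') ∈ G := by
  obtain ⟨g, hg, hgn⟩ := Filter.extraction_of_frequently_atTop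
    (P := fun ℓ => ℓ₀ ≤ ℓ ∧ n ℓ = m) (Filter.frequently_atTop.2 fun N => by
      obtain ⟨ℓ, hℓ, hn⟩ := hfreq (max N ℓ₀)
      exact ⟨ℓ, le_of_max_le_left hℓ, le_of_max_le_right hℓ, hn⟩)
  have hc : ∀ i, c (g i) (n (g i)) = c ℓ₀ m := fun i => by
    rw [(hgn i).2, h.c_eq_of_le hm (hgn i).1]
  let w : ℕ → P := fun i =>
    Classical.epsilon fun z => z ∈ edgeState G φ M n k c (g i) y (n (g i))
  have hw : ∀ i, w i ∈ edgeState G φ M n k c (g i) y (n (g i)) := fun i => (hI _ y).epsilon_mem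
  have hwy : ∀ i, edgePoint G φ M n k c (g i) y = endpoint φ false (w i) := fun i => by
    rw [edgePoint, hc, hy]
  have hwy' : ∀ i, edgePoint G φ M n k c (g i) y' = endpoint φ true (w i) := fun i => by
    have : edgeState G φ M n k c (g i) y' (n (g i)) = edgeState G φ M n k c (g i) y (n (g i)) :=
      h.edgeState_congr le_rfl (fun j _ hj => (hyy j (by rwa [hc] at hj)).symm) _ le_rfl
    rw [edgePoint, hc, hy', this]
  have hcauchy : CauchySeq w := by
    refine cauchySeq_of_le_geometric (1 / 2) 1 (by norm_num) fun i => ?_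
    have hmem : w (i + 1) ∈ edgeState G φ M n k c (g i) y (n (g i)) := by
      have := hw (i + 1)
      rw [(hgn (i + 1)).2] at this
      rw [(hgn i).2]
      exact edgeState_antitone h hφ hI hm (hgn i).1 (hg.monotone (Nat.le_succ i)) y this
    refine (((hI (g i) y).fine _ (hw i) _ hmem).1).trans ?_
    rw [one_mul]
    exact pow_le_pow_of_le_one (by norm_num) (by norm_num) (hg.id_le i)
  obtain ⟨z, hz⟩ := cauchySeq_tendsto_of_complete hcauchy
  have hlim : ∀ {b : Bool} {v : ℕ → Bool} {q : X},
      Filter.Tendsto (fun ℓ => edgePoint G φ M n k c ℓ v) Filter.atTop (nhds q) →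
      (∀ i, edgePoint G φ M n k c (g i) v = endpoint φ b (w i)) → q = endpoint φ b z :=
    fun {b} _ _ hq hv => tendsto_nhds_unique (hq.comp hg.tendsto_atTop)
      (((continuous_endpoint hφ b).tendsto z |>.comp hz).congr fun i => (hv i).symm)
  have h₁ := hlim hl hwy
  have h₂ := hlim hl' hwy'
  rw [← hφG]
  exact ⟨z, Prod.ext h₁.symm h₂.symm⟩

end State

section Guess

variable (e : ℕ ≃ ℕ × ℕ × ℕ) (x : ℕ × ℕ × ℕ → Bool)

theorem kSeg_set_nonempty (ℓ m : ℕ) :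
    {k : ℕ | ¬ ∃ a : ℕ, e.symm (m, k, a) < ℓ ∧ x (m, k, a) = true}.Nonempty := by
  by_contra hne
  rw [Set.not_nonempty_iff_eq_empty, Set.eq_empty_iff_forall_notMem] at hne
  simp only [Set.mem_ofPred_eq, not_not] at hne
  choose a ha using hne
  have hinj : Function.Injective fun k : ℕ => (⟨e.symm (m, k, a k), (ha k).1⟩ : Fin ℓ) := by
    intro k k' hkk
    exact (by simpa using hkk : k = k' ∧ a k = a k').1
  exact not_injective_infinite_finite _ hinj

theorem not_refuted_kSeg (ℓ m : ℕ) :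
    ¬ ∃ a : ℕ, e.symm (m, kSeg e x ℓ m, a) < ℓ ∧ x (m, kSeg e x ℓ m, a) = true :=
  Nat.sInf_mem (kSeg_set_nonempty e x ℓ m)

theorem refuted_of_lt_kSeg {ℓ m k : ℕ} (hk : k < kSeg e x ℓ m) :
    ∃ a : ℕ, e.symm (m, k, a) < ℓ ∧ x (m, k, a) = true :=
  not_not.1 (Nat.notMem_of_lt_sInf hk)

theorem kSeg_mono (m : ℕ) : Monotone fun ℓ => kSeg e x ℓ m := by
  intro ℓ ℓ' hℓ
  refine not_lt.1 fun hlt => not_refuted_kSeg e x ℓ' m ?_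
  obtain ⟨a, ha, hx⟩ := refuted_of_lt_kSeg e x hlt
  exact ⟨a, ha.trans_le hℓ, hx⟩

theorem kSeg_lt_succ_iff (ℓ m : ℕ) : kSeg e x ℓ m < kSeg e x (ℓ + 1) m ↔
    ∃ a : ℕ, e.symm (m, kSeg e x ℓ m, a) < ℓ + 1 ∧ x (m, kSeg e x ℓ m, a) = true := by
  refine ⟨refuted_of_lt_kSeg e x, fun h => lt_of_le_of_ne (kSeg_mono e x m ℓ.le_succ) fun heq => ?_⟩
  rw [heq] at h
  exact not_refuted_kSeg e x (ℓ + 1) m h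

theorem nSeg_succ (ℓ : ℕ) : nSeg e x (ℓ + 1) =
    if ∃ m < nSeg e x ℓ, kSeg e x ℓ m < kSeg e x (ℓ + 1) m then
      sInf {m : ℕ | m < nSeg e x ℓ ∧ kSeg e x ℓ m < kSeg e x (ℓ + 1) m}
    else nSeg e x ℓ + 1 := by
  simp only [kSeg_lt_succ_iff]
  rw [nSeg]

/-- The stage at which the guess for level `j` current at stage `ℓ` was made. -/
noncomputable def cSeg : ℕ → ℕ → ℕ
  | 0, _ => 0
  | ℓ + 1, j => if j = nSeg e x (ℓ + 1) ∧ nSeg e x ℓ < nSeg e x (ℓ + 1) then ℓ + 1 else cSeg ℓ j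

theorem isGuess_seg : IsGuess (nSeg e x) (kSeg e x) (cSeg e x) where
  n_zero := rfl
  k_mono := kSeg_mono e x
  step ℓ := by
    rw [nSeg_succ]
    split_ifs with h
    · exact Or.inl (Nat.sInf_mem h)
    · exact Or.inr rfl
  k_eq ℓ j hj hj' := by
    rw [nSeg_succ] at hj'
    refine le_antisymm (not_lt.1 fun hlt => ?_) (kSeg_mono e x j ℓ.le_succ)
    have hex : ∃ m < nSeg e x ℓ, kSeg e x ℓ m < kSeg e x (ℓ + 1) m := ⟨j, hj, hlt⟩
    rw [if_pos hex] at hj'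
    exact Nat.notMem_of_lt_sInf hj' ⟨hj, hlt⟩
  c_zero _ := rfl
  c_succ _ _ := rfl

theorem kSeg_congr {x x' : ℕ × ℕ × ℕ → Bool} {L ℓ : ℕ} (hx : ∀ i < L, x (e i) = x' (e i))
    (hℓ : ℓ ≤ L) : kSeg e x ℓ = kSeg e x' ℓ := by
  funext m
  have : ∀ k a : ℕ, (e.symm (m, k, a) < ℓ ∧ x (m, k, a) = true) ↔
      (e.symm (m, k, a) < ℓ ∧ x' (m, k, a) = true) := fun k a => by
    refine and_congr_right fun h => ?_
    have := hx _ (h.trans_le hℓ)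
    rw [Equiv.apply_symm_apply] at this
    rw [this]
  simp only [kSeg, this]

theorem nSeg_congr {x x' : ℕ × ℕ × ℕ → Bool} {L ℓ : ℕ} (hx : ∀ i < L, x (e i) = x' (e i))
    (hℓ : ℓ ≤ L) : nSeg e x ℓ = nSeg e x' ℓ := by
  induction ℓ with
  | zero => rfl
  | succ ℓ ih =>
    simp only [nSeg_succ, ih (by omega), kSeg_congr e hx hℓ,
      kSeg_congr e hx (show ℓ ≤ L by omega)]

theorem cSeg_congr {x x' : ℕ × ℕ × ℕ → Bool} {L ℓ : ℕ} (hx : ∀ i < L, x (e i) = x' (e i))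
    (hℓ : ℓ ≤ L) : cSeg e x ℓ = cSeg e x' ℓ := by
  induction ℓ with
  | zero => rfl
  | succ ℓ ih =>
    funext j
    simp only [cSeg, ih (by omega), nSeg_congr e hx hℓ, nSeg_congr e hx (show ℓ ≤ L by omega)]

theorem IsGuess.c_spec {n : ℕ → ℕ} {k c : ℕ → ℕ → ℕ} (h : IsGuess n k c) {ℓ j : ℕ}
    (hj : j ≤ n ℓ) : j ≤ n (c ℓ j) ∧ (∀ i < j, k (c ℓ j) i = k ℓ i) ∧
      ∀ t < c ℓ j, ¬ (j ≤ n t ∧ ∀ i < j, k t i = k ℓ i) := by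
  induction ℓ generalizing j with
  | zero =>
    rw [h.c_zero]
    exact ⟨hj, fun _ _ => rfl, fun t ht => by simp at ht⟩
  | succ ℓ ih =>
    by_cases hjn : j ≤ n ℓ
    · rw [h.c_eq hjn]
      have hk : ∀ i < j, k (ℓ + 1) i = k ℓ i := fun i hi => h.k_eq ℓ i (by omega) (by omega)
      obtain ⟨h₁, h₂, h₃⟩ := ih hjn
      refine ⟨h₁, fun i hi => (h₂ i hi).trans (hk i hi).symm, fun t ht ⟨hn, hkt⟩ => ?_⟩
      exact h₃ t ht ⟨hn, fun i hi => (hkt i hi).trans (hk i hi)⟩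
    · have hpush : j = n (ℓ + 1) ∧ n ℓ < n (ℓ + 1) := by
        rcases h.step ℓ with h' | h' <;> omega
      rw [h.c_succ, if_pos hpush]
      refine ⟨hj, fun _ _ => rfl, fun t ht ⟨hn, hkt⟩ => ?_⟩
      have hstay : ∀ s, t ≤ s → s ≤ ℓ → j ≤ n s := by
        intro s hs
        induction s, hs using Nat.le_induction with
        | base => exact fun _ => hn
        | succ s hs ihs =>
          intro hsℓ
          have := ihs (by omega)
          by_contra hlt
          rcases h.step s with ⟨h₁, h₂⟩ | h'
          · have h₃ := hkt (n (s + 1)) (by omega)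
            have h₄ := h.k_mono (n (s + 1)) hs
            have h₅ := h.k_mono (n (s + 1)) (show s + 1 ≤ ℓ + 1 by omega)
            simp only at h₄ h₅
            omega
          · omega
      exact hjn (hstay ℓ (by omega) le_rfl)

theorem le_nVal_iff {m : ℕ} : (m : ℕ∞) ≤ nVal x ↔ ∀ j < m, lvl1Zero x j := by
  refine ⟨fun h j hj => ?_, fun h => le_sSup ⟨m, rfl, h⟩⟩
  by_contra hz
  have : nVal x ≤ (j : ℕ∞) := sSup_le fun N ⟨n, hN, hn⟩ => by
    rw [hN, Nat.cast_le]
    exact not_lt.1 fun hjn => hz (hn j hjn)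
  have := Nat.cast_le.1 (h.trans this)
  omega

variable {x}

theorem kSeg_eventually {m : ℕ} (hm : lvl1Zero x m) :
    ∃ L, ∀ ℓ ≥ L, kSeg e x ℓ m = kVal x m := by
  have hk : ¬ lvl2Zero x m (kVal x m) := Nat.sInf_mem hm
  have hlt : ∀ k < kVal x m, ∃ a, x (m, k, a) = true := fun k hk =>
    not_not.1 (Nat.notMem_of_lt_sInf hk)
  choose! a ha using hlt
  refine ⟨(Finset.range (kVal x m)).sup (fun k => e.symm (m, k, a k)) + 1, fun ℓ hℓ => ?_⟩
  refine le_antisymm (Nat.sInf_le fun ⟨b, _, hb⟩ => hk ⟨b, hb⟩) (not_lt.1 fun hlt => ?_)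
  refine not_refuted_kSeg e x ℓ m ⟨a (kSeg e x ℓ m), ?_, ha _ hlt⟩
  have := Finset.le_sup (f := fun k => e.symm (m, k, a k)) (Finset.mem_range.2 hlt)
  omega

theorem kVal_eq_of_eventually {m L v : ℕ} (hv : ∀ ℓ ≥ L, kSeg e x ℓ m = v) :
    lvl1Zero x m ∧ kVal x m = v := by
  have hz : ¬ lvl2Zero x m v := fun ⟨a, ha⟩ => by
    have h := not_refuted_kSeg e x (max L (e.symm (m, v, a) + 1)) m
    rw [hv _ (le_max_left _ _)] at h
    exact h ⟨a, lt_of_lt_of_le (Nat.lt_succ_self _) (le_max_right _ _), ha⟩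
  have h₁ : lvl1Zero x m := ⟨v, hz⟩
  obtain ⟨L', hL'⟩ := kSeg_eventually e h₁
  exact ⟨h₁, by rw [← hL' (max L L') (le_max_right _ _), hv _ (le_max_left _ _)]⟩

theorem sqSub_eventually {m : ℕ} (hm : (m : ℕ∞) ≤ nVal x) : ∃ L, ∀ ℓ ≥ L, sqSub e x m ℓ := by
  have hz := (le_nVal_iff x).1 hm
  have hK : ∃ L, ∀ ℓ ≥ L, ∀ j < m, kSeg e x ℓ j = kVal x j := by
    have : ∀ j, ∃ L, j < m → ∀ ℓ ≥ L, kSeg e x ℓ j = kVal x j := fun j => by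
      by_cases hj : j < m
      · obtain ⟨L, hL⟩ := kSeg_eventually e (hz j hj)
        exact ⟨L, fun _ => hL⟩
      · exact ⟨0, fun h => absurd h hj⟩
    choose L hL using this
    refine ⟨(Finset.range m).sup L, fun ℓ hℓ j hj => hL j hj ℓ ?_⟩
    exact (Finset.le_sup (f := L) (Finset.mem_range.2 hj)).trans hℓ
  obtain ⟨L, hL⟩ := hK
  have hstep : ∀ ℓ ≥ L, m ≤ nSeg e x (ℓ + 1) ∨ nSeg e x (ℓ + 1) = nSeg e x ℓ + 1 := by
    intro ℓ hℓ
    rcases (isGuess_seg e x).step ℓ with ⟨-, h₂⟩ | h'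
    · refine Or.inl (not_lt.1 fun hlt => ?_)
      rw [hL ℓ hℓ _ hlt, hL (ℓ + 1) (by omega) _ hlt] at h₂
      exact lt_irrefl _ h₂
    · exact Or.inr h'
  have hgrow : ∀ i, m ≤ nSeg e x (L + i) ∨ i ≤ nSeg e x (L + i) := by
    intro i
    induction i with
    | zero => exact Or.inr (Nat.zero_le _)
    | succ i ih =>
      have := hstep (L + i) (by omega)
      rw [← add_assoc]
      omega
  refine ⟨L + m, fun ℓ hℓ => ⟨?_, hm, hL ℓ (by omega)⟩⟩
  have := hgrow (ℓ - L)
  rw [show L + (ℓ - L) = ℓ by omega] at this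
  omega

theorem cSeg_eq_cVal {m ℓ : ℕ} (h : sqSub e x m ℓ) : cSeg e x ℓ m = cVal e x m := by
  obtain ⟨h₁, h₂, h₃⟩ := h
  obtain ⟨c₁, c₂, c₃⟩ := (isGuess_seg e x).c_spec h₁
  refine le_antisymm (not_lt.1 fun hlt => ?_)
    (Nat.sInf_le ⟨c₁, h₂, fun j hj => (c₂ j hj).trans (h₃ j hj)⟩)
  have hmem : sqSub e x m (cVal e x m) :=
    Nat.sInf_mem (s := {ℓ | sqSub e x m ℓ}) ⟨ℓ, h₁, h₂, h₃⟩
  exact c₃ _ hlt ⟨hmem.1, fun j hj => (hmem.2.2 j hj).trans (h₃ j hj).symm⟩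

/-- A stage after which the guessed length never drops below its current value is correct. -/
theorem sqSub_of_forall_le {ℓ : ℕ} (h : ∀ ℓ' ≥ ℓ, nSeg e x ℓ ≤ nSeg e x ℓ') :
    sqSub e x (nSeg e x ℓ) ℓ := by
  have hk : ∀ j < nSeg e x ℓ, ∀ ℓ' ≥ ℓ, kSeg e x ℓ' j = kSeg e x ℓ j := by
    intro j hj ℓ' hℓ'
    induction ℓ', hℓ' using Nat.le_induction with
    | base => rfl
    | succ ℓ' hℓ' ih =>
      rw [(isGuess_seg e x).k_eq ℓ' j (hj.trans_le (h ℓ' hℓ'))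
        (hj.trans_le (h (ℓ' + 1) (by omega))), ih]
  have hv := fun j hj => kVal_eq_of_eventually e (hk j hj)
  exact ⟨le_rfl, (le_nVal_iff x).2 fun j hj => (hv j hj).1, fun j hj => (hv j hj).2.symm⟩

theorem exists_sqSub_nSeg (N : ℕ) : ∃ ℓ ≥ N, sqSub e x (nSeg e x ℓ) ℓ := by
  have hex : ∃ v, ∃ ℓ ≥ N, nSeg e x ℓ = v := ⟨_, N, le_rfl, rfl⟩
  obtain ⟨ℓ, hℓ, hv⟩ := Nat.find_spec hex
  refine ⟨ℓ, hℓ, sqSub_of_forall_le e fun ℓ' hℓ' => ?_⟩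
  rw [hv]
  exact Nat.find_min' hex ⟨ℓ', hℓ.trans hℓ', rfl⟩

theorem sqSub.mono {m m' ℓ : ℕ} (h : sqSub e x m ℓ) (hm : m' ≤ m) : sqSub e x m' ℓ :=
  ⟨hm.trans h.1, (Nat.cast_le.2 hm).trans h.2.1, fun j hj => h.2.2 j (hj.trans_le hm)⟩

theorem memY3.bitsCoded {M : ℕ → ℕ → Bool} {a : XThree} (ha : memY3 e M a) {ℓ : ℕ}
    (h : sqSub e a.1 (nSeg e a.1 ℓ) ℓ) :
    BitsCoded M (nSeg e a.1) (kSeg e a.1) (cSeg e a.1) ℓ a.2 := by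
  intro j hj
  rw [h.2.2 j hj, cSeg_eq_cVal e (h.mono e hj.le)]
  exact ha j ((Nat.cast_lt.2 hj).trans_le h.2.1) _ le_rfl

end Guess

theorem sigmaClass_three_of_isGδ {X : Type*} [TopologicalSpace X] {A : Set X} (hA : IsGδ A) :
    SigmaClass X 3 A := by
  obtain ⟨U, hU, rfl⟩ := isGδ_iff_eq_iInter_nat.1 hA
  have h₂ : SigmaClass X 2 (⋃ n, (U n)ᶜ) :=
    .union 2 (fun _ => 1) U (by norm_num) (fun _ => le_rfl) (fun _ => by norm_num)
      fun n => .open_ _ (hU n)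
  have h₃ := SigmaClass.union 3 (fun _ => 2) (fun _ : ℕ => ⋃ n, (U n)ᶜ) (by norm_num)
    (fun _ => by norm_num) (fun _ => by norm_num) fun _ => h₂
  rwa [Set.iUnion_const, ← Set.compl_iInter, compl_compl] at h₃

theorem exists_homomorphism (e : ℕ ≃ ℕ × ℕ × ℕ) (M : ℕ → ℕ → Bool) {X P : Type*}
    [MetricSpace X] [CompleteSpace X] [MetricSpace P] [CompleteSpace P]
    [SecondCountableTopology P] [Nonempty P] {G : Set (X × X)} {φ : P → X × X}
    (hφ : Continuous φ) (hφG : Set.range φ = G) (hG : ¬ GdeltaSmall G Set.univ) :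
    ∃ f : {a : XThree // memY3 e M a} → X, Continuous f ∧
      ∀ a b : {a : XThree // memY3 e M a}, H3Edge e M a.1 b.1 → (f a, f b) ∈ G := by
  have hg := isGuess_seg e
  have hI : ∀ x ℓ y, StateInv G φ M (nSeg e x) (kSeg e x) (cSeg e x) ℓ y :=
    fun x => stateInv (hg x) hφ hφG hG
  have hbits : ∀ a : {a : XThree // memY3 e M a}, ∀ N, ∃ ℓ ≥ N,
      BitsCoded M (nSeg e a.1.1) (kSeg e a.1.1) (cSeg e a.1.1) ℓ a.1.2 := fun a N => by
    obtain ⟨ℓ, hℓ, h⟩ := exists_sqSub_nSeg e (x := a.1.1) N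
    exact ⟨ℓ, hℓ, a.2.bitsCoded e h⟩
  choose f hf using fun a : {a : XThree // memY3 e M a} =>
    exists_tendsto_edgePoint (hg a.1.1) hφ (hI a.1.1) (hbits a)
  refine ⟨f, continuous_iff_continuousAt.2 fun a => Metric.tendsto_nhds.2 fun ε hε => ?_, ?_⟩
  · obtain ⟨N, hN⟩ := exists_pow_lt_of_lt_one (show 0 < ε / 4 by positivity)
      (one_half_lt_one (α := ℝ))
    obtain ⟨ℓ, hℓ, hb⟩ := hbits a N
    have hcont₁ : ∀ i, Continuous fun a' : {a : XThree // memY3 e M a} => a'.1.1 (e i) :=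
      fun i => (continuous_apply (e i)).comp (continuous_fst.comp continuous_subtype_val)
    have hcont₂ : ∀ i, Continuous fun a' : {a : XThree // memY3 e M a} => a'.1.2 i :=
      fun i => (continuous_apply i).comp (continuous_snd.comp continuous_subtype_val)
    have hx : ∀ᶠ a' in nhds a, ∀ i ∈ Finset.range ℓ, a'.1.1 (e i) = a.1.1 (e i) :=
      (Finset.eventually_all _).2 fun i _ => (hcont₁ i).continuousAt.eventually
        (IsOpen.mem_nhds (isOpen_discrete {a.1.1 (e i)}) rfl)
    have hy : ∀ᶠ a' in nhds a, ∀ i ∈ Finset.range (ℓ + 1), a'.1.2 i = a.1.2 i :=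
      (Finset.eventually_all _).2 fun i _ => (hcont₂ i).continuousAt.eventually
        (IsOpen.mem_nhds (isOpen_discrete {a.1.2 i}) rfl)
    filter_upwards [hx, hy] with a' hx hy
    have hx' : ∀ i < ℓ, a'.1.1 (e i) = a.1.1 (e i) := fun i hi => hx i (Finset.mem_range.2 hi)
    have hy' : ∀ i ≤ ℓ, a'.1.2 i = a.1.2 i := fun i hi =>
      hy i (Finset.mem_range.2 (Nat.lt_succ_of_le hi))
    have hn := fun t (ht : t ≤ ℓ) => nSeg_congr e hx' ht
    have hk := fun t (ht : t ≤ ℓ) => kSeg_congr e hx' ht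
    have hc := fun t (ht : t ≤ ℓ) => cSeg_congr e hx' ht
    have hb' : BitsCoded M (nSeg e a'.1.1) (kSeg e a'.1.1) (cSeg e a'.1.1) ℓ a'.1.2 := by
      intro j hj
      rw [hn ℓ le_rfl] at hj
      rw [hk ℓ le_rfl, hc ℓ le_rfl, hy' _ ((hg a.1.1).c_le ℓ j)]
      exact hb j hj
    have hp : edgePoint G φ M (nSeg e a'.1.1) (kSeg e a'.1.1) (cSeg e a'.1.1) ℓ a'.1.2 =
        edgePoint G φ M (nSeg e a.1.1) (kSeg e a.1.1) (cSeg e a.1.1) ℓ a.1.2 := by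
      rw [edgePoint, edgePoint, edgeState_congr_guess hn hk hc, hn ℓ le_rfl, hc ℓ le_rfl,
        hy' _ ((hg a.1.1).c_le ℓ _),
        (hg a.1.1).edgeState_congr le_rfl (fun i hi _ => hy' i hi) _ le_rfl]
    have h₁ := hb.dist_limit_le (hg a.1.1) hφ (hI a.1.1) (hf a)
    have h₂ := hb'.dist_limit_le (hg a'.1.1) hφ (hI a'.1.1) (hf a')
    rw [hp] at h₂
    have h₃ : ((1 : ℝ) / 2) ^ ℓ ≤ (1 / 2) ^ N :=
      pow_le_pow_of_le_one (by norm_num) (by norm_num) hℓ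
    linarith [dist_triangle_right (f a') (f a)
      (edgePoint G φ M (nSeg e a.1.1) (kSeg e a.1.1) (cSeg e a.1.1) ℓ a.1.2)]
  · rintro a b ⟨-, -, hab, m, hm, ha, hb, hne⟩
    obtain ⟨ℓ₀, hℓ₀⟩ := sqSub_eventually e hm.ge
    rw [← cSeg_eq_cVal e (hℓ₀ ℓ₀ le_rfl)] at ha hb hne
    refine limit_edge (hg a.1.1) hφ hφG (hI a.1.1) (fun ℓ hℓ => (hℓ₀ ℓ hℓ).1) (fun N => ?_)
      ha hb hne (hf a) (hab ▸ hf b)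
    obtain ⟨ℓ, hℓ, h⟩ := exists_sqSub_nSeg e (x := a.1.1) (max N ℓ₀)
    refine ⟨ℓ, le_of_max_le_left hℓ, le_antisymm ?_ (hℓ₀ ℓ (le_of_max_le_right hℓ)).1⟩
    exact Nat.cast_le.1 (h.2.1.trans hm.le)

/-- minimality of `H₃`. Let `X` be a Polish space and `G` an
analytic directed graph on `X` with no countable `Σ^0_3` colouring. Then there is a
continuous `f : Y₃ → X` (with `Y₃` carrying the subspace topology from `X₃`) mapping
every `H₃`-edge to an edge of `G`. -/
theorem minimality_of_H3 (e : ℕ ≃ ℕ × ℕ × ℕ) (M : ℕ → ℕ → Bool) (hM : DenseRange M)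
    (X : Type) [TopologicalSpace X] [PolishSpace X]
    (G : Set (X × X)) (hG : MeasureTheory.AnalyticSet G)
    (hcol : ¬ ∃ C : ℕ → Set X,
      (∀ n : ℕ, SigmaClass X 3 (C n)) ∧
      (⋃ n : ℕ, C n) = Set.univ ∧
      (∀ (n : ℕ) (a b : X), (a, b) ∈ G → ¬ (a ∈ C n ∧ b ∈ C n))) :
    ∃ f : {a : XThree // memY3 e M a} → X, Continuous f ∧
      ∀ a b : {a : XThree // memY3 e M a},
        H3Edge e M a.1 b.1 → (f a, f b) ∈ G := by
  have hsmall : ¬ GdeltaSmall G Set.univ := fun ⟨C, hC, hcov⟩ =>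
    hcol ⟨C, fun n => sigmaClass_three_of_isGδ (hC n).1, Set.univ_subset_iff.1 hcov,
      fun n a b hab h => (hC n).2 a h.1 b h.2 hab⟩
  rw [MeasureTheory.AnalyticSet] at hG
  rcases hG with rfl | ⟨φ, hφ, hφG⟩
  · exact absurd (.of_indep .univ (by simp)) hsmall
  · let _ := TopologicalSpace.upgradeIsCompletelyMetrizable X
    let _ := TopologicalSpace.upgradeIsCompletelyMetrizable (ℕ → ℕ)
    exact exists_homomorphism e M hφ hφG hsmall
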